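/- Let m ≥ 3 and let S be the subdivision graph of the complete bipartite graph K_{m,m}. For a rational λ > 1, S is edge quasi-λ-distance-balanced (λ-EQDB) if and only if λ = (m² − 1)/(2m − 1). -/

import Mathlib

open SimpleGraph


/-- Distance from a vertex to an edge (unordered pair): min of distances to the endpoints. -/
noncomputable def evdist {V : Type*} (G : SimpleGraph V) (g : V) (e : Sym2 V) : ℕ :=
  Sym2.lift ⟨fun u v => min (G.dist g u) (G.dist g v), fun _ _ => min_comm _ _⟩ e

/-- `mcount G g h` is the number of edges of `G` strictly closer to `g` than to `h`. -/
noncomputable def mcount {V : Type*} (G : SimpleGraph V) (g h : V) : ℕ :=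
  {e ∈ G.edgeSet | evdist G g e < evdist G h e}.ncard

/-- `m0count G g h` is the number of edges of `G`, other than `s(g,h)` itself, that are
equidistant from `g` and from `h`. -/
noncomputable def m0count {V : Type*} (G : SimpleGraph V) (g h : V) : ℕ :=
  {e ∈ G.edgeSet | e ≠ s(g, h) ∧ evdist G g e = evdist G h e}.ncard

/-- `ncount G g h` is the number of vertices of `G` strictly closer to `g` than to `h`. -/
noncomputable def ncount {V : Type*} (G : SimpleGraph V) (g h : V) : ℕ :=
  {w : V | G.dist w g < G.dist w h}.ncard

/-- Edge quasi-λ-distance-balanced. -/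
def IsEQDB {V : Type*} (G : SimpleGraph V) (lam : ℚ) : Prop :=
  ∀ g h : V, G.Adj g h →
    (mcount G g h : ℚ) = lam * mcount G h g ∨ (mcount G h g : ℚ) = lam * mcount G g h

/-- Quasi-λ-distance-balanced. -/
def IsQDB {V : Type*} (G : SimpleGraph V) (lam : ℚ) : Prop :=
  ∀ g h : V, G.Adj g h →
    (ncount G g h : ℚ) = lam * ncount G h g ∨ (ncount G h g : ℚ) = lam * ncount G g h


/-- The subdivision graph `S(G)`: vertices are `V(G) ⊕ E(G)`, with an original vertex adjacent
to a subdivision vertex iff it is an endpoint of the corresponding edge. -/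
def subdivision {V : Type*} (G : SimpleGraph V) : SimpleGraph (V ⊕ G.edgeSet) where
  Adj x y :=
    match x, y with
    | Sum.inl v, Sum.inr e => v ∈ (e : Sym2 V)
    | Sum.inr e, Sum.inl v => v ∈ (e : Sym2 V)
    | _, _ => False
  symm := ⟨by rintro (v | e) (w | f) h <;> exact h⟩
  loopless := ⟨by rintro (v | e) h <;> exact h⟩

/-- A `1`-Lipschitz potential vanishing at `g` that can be decreased along an edge away from `g`
is the distance from `g`. -/
theorem SimpleGraph.dist_eq_of_potential {V : Type*} {G : SimpleGraph V} {g : V} (f : V → ℕ)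
    (hg : f g = 0) (hlip : ∀ x y, G.Adj x y → f y ≤ f x + 1)
    (hdesc : ∀ w, w ≠ g → ∃ x, G.Adj x w ∧ f w = f x + 1) (w : V) :
    G.Reachable g w ∧ G.dist g w = f w := by
  have hup : ∀ n w, f w = n → ∃ p : G.Walk g w, p.length = n := by
    intro n
    induction n with
    | zero =>
      intro w hw
      by_cases h : w = g
      · subst h; exact ⟨.nil, rfl⟩
      · obtain ⟨x, -, hx⟩ := hdesc w h
        omega
    | succ n ih =>
      intro w hw
      obtain ⟨x, hxw, hx⟩ := hdesc w (by rintro rfl; omega)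
      obtain ⟨p, hp⟩ := ih x (by omega)
      exact ⟨p.concat hxw, by simp [hp]⟩
  have hlow : ∀ {u v : V} (p : G.Walk u v), f v ≤ f u + p.length := by
    intro u v p
    induction p with
    | nil => simp
    | cons h p ih =>
      have := hlip _ _ h
      rw [Walk.length_cons]
      omega
  obtain ⟨p, hp⟩ := hup _ w rfl
  refine ⟨p.reachable, le_antisymm (hp ▸ dist_le p) ?_⟩
  obtain ⟨q, hq⟩ := p.reachable.exists_walk_length_eq_dist
  have := hlow q
  omega

/-- If `u` and `v` are the only neighbours of `w ≠ x`, then a geodesic from `x` to `w` enters `w`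
through the closer one of them. -/
theorem SimpleGraph.Connected.dist_eq_one_add_min {V : Type*} {G : SimpleGraph V}
    (hG : G.Connected) {x w u v : V} (hne : x ≠ w) (hw : ∀ y, G.Adj w y ↔ y = u ∨ y = v) :
    G.dist x w = 1 + min (G.dist x u) (G.dist x v) := by
  have hle : ∀ y, G.Adj w y → G.dist x w ≤ G.dist x y + 1 := fun y hy => by
    simpa [dist_eq_one_iff_adj.2 hy.symm] using hG.dist_triangle (u := x) (v := y) (w := w)
  have hu := hle u ((hw u).2 (.inl rfl))
  have hv := hle v ((hw v).2 (.inr rfl))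
  obtain ⟨p, hp⟩ := hG.exists_walk_length_eq_dist w x
  rw [SimpleGraph.dist_comm] at hp
  cases p with
  | nil => exact absurd rfl hne
  | cons h p =>
    have hq := dist_le p
    rw [SimpleGraph.dist_comm] at hq
    rw [Walk.length_cons] at hp
    rcases (hw _).1 h with rfl | rfl <;> omega

section Subdivision

variable {V : Type*} {G : SimpleGraph V}

@[simp]
theorem evdist_mk (g u v : V) : evdist G g s(u, v) = min (G.dist g u) (G.dist g v) := rfl

@[simp]
theorem subdivision_adj_inl_inr (v : V) (e : G.edgeSet) :
    (subdivision G).Adj (.inl v) (.inr e) ↔ v ∈ (e : Sym2 V) := Iff.rfl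

@[simp]
theorem subdivision_adj_inr_inl (v : V) (e : G.edgeSet) :
    (subdivision G).Adj (.inr e) (.inl v) ↔ v ∈ (e : Sym2 V) := Iff.rfl

@[simp]
theorem not_subdivision_adj_inl_inl (v w : V) : ¬(subdivision G).Adj (.inl v) (.inl w) := id

@[simp]
theorem not_subdivision_adj_inr_inr (e f : G.edgeSet) : ¬(subdivision G).Adj (.inr e) (.inr f) :=
  id

theorem subdivision_reachable_and_dist_inl (hG : G.Connected) (v : V) (w : V ⊕ G.edgeSet) :
    (subdivision G).Reachable (.inl v) w ∧ (subdivision G).dist (.inl v) w =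
      Sum.elim (fun u => 2 * G.dist v u) (fun e : G.edgeSet => 1 + 2 * evdist G v e) w := by
  have hle : ∀ {u y}, G.Adj u y → G.dist v u ≤ G.dist v y + 1 := fun {u y} h => by
    simpa [dist_eq_one_iff_adj.2 h.symm] using hG.dist_triangle (u := v) (v := y) (w := u)
  refine dist_eq_of_potential (G := subdivision G) (g := Sum.inl v)
    (Sum.elim (fun u => 2 * G.dist v u) (fun e : G.edgeSet => 1 + 2 * evdist G v e)) (by simp) ?_ ?_ w
  · rintro (x | ⟨e, he⟩) (y | ⟨f, hf⟩) h
    · exact absurd h (not_subdivision_adj_inl_inl _ _)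
    · obtain ⟨z, rfl⟩ := Sym2.mem_iff_exists.1 h
      simp only [Sum.elim_inl, Sum.elim_inr, evdist_mk]
      omega
    · obtain ⟨z, rfl⟩ := Sym2.mem_iff_exists.1 h
      have := hle (show G.Adj y z from he)
      simp only [Sum.elim_inl, Sum.elim_inr, evdist_mk]
      omega
    · exact absurd h (not_subdivision_adj_inr_inr _ _)
  · rintro (x | ⟨e, he⟩) hne
    · obtain ⟨p, hp⟩ := hG.exists_walk_length_eq_dist x v
      cases p with
      | nil => exact absurd rfl hne
      | @cons _ y _ h p =>
        refine ⟨.inr ⟨s(x, y), h⟩, by simp, ?_⟩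
        have h1 := dist_le p
        have h2 := hle h
        rw [Walk.length_cons, SimpleGraph.dist_comm] at hp
        rw [SimpleGraph.dist_comm] at h1
        simp only [Sum.elim_inl, Sum.elim_inr, evdist_mk]
        omega
    · induction e using Sym2.ind with
      | _ x y =>
        rcases le_total (G.dist v x) (G.dist v y) with h | h
        · exact ⟨.inl x, by simp, by simp [h, add_comm]⟩
        · exact ⟨.inl y, by simp, by simp [h, add_comm]⟩

theorem subdivision_connected (hG : G.Connected) : (subdivision G).Connected := by
  obtain ⟨v⟩ := hG.nonempty
  exact connected_iff_exists_forall_reachable _ |>.2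
    ⟨.inl v, fun w => (subdivision_reachable_and_dist_inl hG v w).1⟩

theorem subdivision_dist_inl_inl (hG : G.Connected) (v w : V) :
    (subdivision G).dist (.inl v) (.inl w) = 2 * G.dist v w :=
  (subdivision_reachable_and_dist_inl hG v _).2

theorem subdivision_dist_inr_inl (hG : G.Connected) (e : G.edgeSet) (w : V) :
    (subdivision G).dist (.inr e) (.inl w) = 1 + 2 * evdist G w e := by
  rw [SimpleGraph.dist_comm]
  exact (subdivision_reachable_and_dist_inl hG w _).2

/-- The distance from `x` to the half-edge at `u` of the edge `s(u, v)`. -/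
theorem evdist_subdivision_halfEdge (hG : G.Connected) {x : V ⊕ G.edgeSet} {e : G.edgeSet}
    {u v : V} (he : (e : Sym2 V) = s(u, v)) (hx : x ≠ .inr e) :
    evdist (subdivision G) x s(.inl u, .inr e) =
      min ((subdivision G).dist x (.inl u)) (1 + (subdivision G).dist x (.inl v)) := by
  have := (subdivision_connected hG).dist_eq_one_add_min (u := .inl u) (v := .inl v) hx (by
    rintro (y | f) <;> simp [he])
  rw [evdist_mk, this]
  omega

end Subdivision

section CompleteBipartite

variable {V ι κ : Type*} {G : SimpleGraph V}

/-- The edge of a complete bipartite graph joining the `i`-th vertex of the first part to the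
`j`-th vertex of the second part. -/
def biEdge (φ : completeBipartiteGraph ι κ ≃g G) (i : ι) (j : κ) : G.edgeSet :=
  ⟨s(φ (.inl i), φ (.inr j)), by simp [φ.map_adj_iff]⟩

/-- The edges of the subdivision of a complete bipartite graph: each edge of the original graph
gives one half at the first part and one half at the second part. -/
def halfEdge (φ : completeBipartiteGraph ι κ ≃g G) :
    (ι × κ) ⊕ (ι × κ) → Sym2 (V ⊕ G.edgeSet)
  | .inl (i, j) => s(.inl (φ (.inl i)), .inr (biEdge φ i j))
  | .inr (i, j) => s(.inl (φ (.inr j)), .inr (biEdge φ i j))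

theorem coe_biEdge (φ : completeBipartiteGraph ι κ ≃g G) (i : ι) (j : κ) :
    (biEdge φ i j : Sym2 V) = s(φ (.inl i), φ (.inr j)) := rfl

theorem biEdge_inj (φ : completeBipartiteGraph ι κ ≃g G) {i i' : ι} {j j' : κ} :
    biEdge φ i j = biEdge φ i' j' ↔ i = i' ∧ j = j' := by
  simp [Subtype.ext_iff, coe_biEdge]

theorem exists_eq_biEdge (φ : completeBipartiteGraph ι κ ≃g G) (e : G.edgeSet) :
    ∃ i j, e = biEdge φ i j := by
  obtain ⟨e, he⟩ := e
  induction e using Sym2.ind with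
  | _ x y =>
    obtain ⟨x, rfl⟩ := φ.surjective x
    obtain ⟨y, rfl⟩ := φ.surjective y
    have h : (completeBipartiteGraph ι κ).Adj x y := φ.map_adj_iff.1 he
    rcases x with i | i <;> rcases y with j | j
    · simp at h
    · exact ⟨i, j, rfl⟩
    · exact ⟨j, i, Subtype.ext Sym2.eq_swap⟩
    · simp at h

theorem halfEdge_injective (φ : completeBipartiteGraph ι κ ≃g G) :
    Function.Injective (halfEdge φ) := by
  rintro (⟨i, j⟩ | ⟨i, j⟩) (⟨i', j'⟩ | ⟨i', j'⟩) h <;>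
    simp_all [halfEdge, biEdge_inj]

theorem edgeSet_subdivision_eq_range_halfEdge (φ : completeBipartiteGraph ι κ ≃g G) :
    (subdivision G).edgeSet = Set.range (halfEdge φ) := by
  have key : ∀ v (e : G.edgeSet), v ∈ (e : Sym2 V) →
      s(.inl v, .inr e) ∈ Set.range (halfEdge φ) := by
    intro v e hv
    obtain ⟨i, j, rfl⟩ := exists_eq_biEdge φ e
    rw [coe_biEdge, Sym2.mem_iff] at hv
    rcases hv with rfl | rfl
    · exact ⟨.inl (i, j), rfl⟩
    · exact ⟨.inr (i, j), rfl⟩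
  refine Set.Subset.antisymm (fun x => ?_) ?_
  · induction x using Sym2.ind with
    | _ x y =>
      rcases x with v | e <;> rcases y with w | f <;> intro h
      · exact absurd h (not_subdivision_adj_inl_inl (G := G) v w)
      · exact key _ _ h
      · rw [Sym2.eq_swap]
        exact key _ _ h
      · exact absurd h (not_subdivision_adj_inr_inr (G := G) e f)
  · rintro _ ⟨⟨i, j⟩ | ⟨i, j⟩, rfl⟩ <;> simp [halfEdge, coe_biEdge]

theorem mcount_subdivision_eq_ncard (φ : completeBipartiteGraph ι κ ≃g G) (g h : V ⊕ G.edgeSet) :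
    mcount (subdivision G) g h =
      {x | evdist (subdivision G) g (halfEdge φ x) <
        evdist (subdivision G) h (halfEdge φ x)}.ncard := by
  rw [mcount, ← Set.ncard_image_of_injective _ (halfEdge_injective φ),
    edgeSet_subdivision_eq_range_halfEdge φ]
  congr 1
  ext
  simp only [Set.mem_image, Set.mem_ofPred_eq, Set.mem_range]
  grind

theorem dist_iso_inl_inr (φ : completeBipartiteGraph ι κ ≃g G) (i : ι) (j : κ) :
    G.dist (φ (.inl i)) (φ (.inr j)) = 1 := by
  simp [dist_eq_one_iff_adj, φ.map_adj_iff]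

theorem dist_iso_inr_inl (φ : completeBipartiteGraph ι κ ≃g G) (i : ι) (j : κ) :
    G.dist (φ (.inr j)) (φ (.inl i)) = 1 := by
  rw [SimpleGraph.dist_comm, dist_iso_inl_inr]

theorem connected_of_iso_completeBipartite [Nonempty ι] [Nonempty κ]
    (φ : completeBipartiteGraph ι κ ≃g G) : G.Connected := by
  obtain ⟨i⟩ := ‹Nonempty ι›
  obtain ⟨j⟩ := ‹Nonempty κ›
  refine connected_iff_exists_forall_reachable _ |>.2 ⟨φ (.inl i), fun w => ?_⟩
  obtain ⟨w, rfl⟩ := φ.surjective w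
  have hadj : ∀ i j, G.Adj (φ (.inl i)) (φ (.inr j)) := by simp [φ.map_adj_iff]
  rcases w with k | k
  · exact (hadj i j).reachable.trans (hadj k j).reachable.symm
  · exact (hadj i k).reachable

theorem dist_eq_two_of_common_neighbor {u v w : V} (huv : u ≠ v) (hn : ¬G.Adj u v)
    (hu : G.Adj u w) (hv : G.Adj w v) : G.dist u v = 2 := by
  have h1 := dist_le (Walk.cons hu hv.toWalk)
  have h2 := (hu.reachable.trans hv.reachable).one_lt_dist_of_ne_of_not_adj huv hn
  simp only [Walk.length_cons, Walk.length_nil] at h1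
  omega

theorem dist_iso_inl_inl [DecidableEq ι] [Nonempty κ] (φ : completeBipartiteGraph ι κ ≃g G)
    (i i' : ι) : G.dist (φ (.inl i)) (φ (.inl i')) = if i = i' then 0 else 2 := by
  obtain ⟨j⟩ := ‹Nonempty κ›
  split_ifs with h
  · simp [h]
  · apply dist_eq_two_of_common_neighbor (w := φ (.inr j)) <;> simp [φ.map_adj_iff, h]

theorem dist_iso_inr_inr [DecidableEq κ] [Nonempty ι] (φ : completeBipartiteGraph ι κ ≃g G)
    (j j' : κ) : G.dist (φ (.inr j)) (φ (.inr j')) = if j = j' then 0 else 2 := by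
  obtain ⟨i⟩ := ‹Nonempty ι›
  split_ifs with h
  · simp [h]
  · apply dist_eq_two_of_common_neighbor (w := φ (.inl i)) <;> simp [φ.map_adj_iff, h]

theorem evdist_inl_halfEdge_inl [DecidableEq ι] [Nonempty ι] [Nonempty κ] (φ : completeBipartiteGraph ι κ ≃g G)
    (a i : ι) (j : κ) :
    evdist (subdivision G) (.inl (φ (.inl a))) (halfEdge φ (.inl (i, j))) =
      if a = i then 0 else 3 := by
  have hG := connected_of_iso_completeBipartite φ
  rw [halfEdge, evdist_subdivision_halfEdge hG (coe_biEdge φ i j) (by simp)]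
  simp only [subdivision_dist_inl_inl hG, dist_iso_inl_inl, dist_iso_inl_inr]
  split_ifs <;> rfl

theorem evdist_inl_halfEdge_inr [DecidableEq ι] [Nonempty ι] [Nonempty κ] (φ : completeBipartiteGraph ι κ ≃g G)
    (a i : ι) (j : κ) :
    evdist (subdivision G) (.inl (φ (.inl a))) (halfEdge φ (.inr (i, j))) =
      if a = i then 1 else 2 := by
  have hG := connected_of_iso_completeBipartite φ
  rw [halfEdge, evdist_subdivision_halfEdge hG ((coe_biEdge φ i j).trans Sym2.eq_swap) (by simp)]
  simp only [subdivision_dist_inl_inl hG, dist_iso_inl_inl, dist_iso_inl_inr]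
  split_ifs <;> rfl

variable [DecidableEq ι] [DecidableEq κ]

theorem evdist_inr_halfEdge_inl [Nonempty ι] [Nonempty κ] (φ : completeBipartiteGraph ι κ ≃g G)
    (a i : ι) (b j : κ) :
    evdist (subdivision G) (.inr (biEdge φ a b)) (halfEdge φ (.inl (i, j))) =
      if a = i then (if b = j then 0 else 1) else (if b = j then 2 else 3) := by
  have hG := connected_of_iso_completeBipartite φ
  by_cases h : a = i ∧ b = j
  · obtain ⟨rfl, rfl⟩ := h
    simp [halfEdge]
  · rw [halfEdge, evdist_subdivision_halfEdge hG (coe_biEdge φ i j)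
      (by simpa [biEdge_inj] using h)]
    simp only [subdivision_dist_inr_inl hG, coe_biEdge, evdist_mk, dist_iso_inl_inl,
      dist_iso_inl_inr, dist_iso_inr_inl, dist_iso_inr_inr]
    grind

theorem evdist_inr_halfEdge_inr [Nonempty ι] [Nonempty κ] (φ : completeBipartiteGraph ι κ ≃g G)
    (a i : ι) (b j : κ) :
    evdist (subdivision G) (.inr (biEdge φ a b)) (halfEdge φ (.inr (i, j))) =
      if b = j then (if a = i then 0 else 1) else (if a = i then 2 else 3) := by
  have hG := connected_of_iso_completeBipartite φ
  by_cases h : a = i ∧ b = j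
  · obtain ⟨rfl, rfl⟩ := h
    simp [halfEdge]
  · rw [halfEdge, evdist_subdivision_halfEdge hG ((coe_biEdge φ i j).trans Sym2.eq_swap)
      (by simpa [biEdge_inj] using h)]
    simp only [subdivision_dist_inr_inl hG, coe_biEdge, evdist_mk, dist_iso_inl_inl,
      dist_iso_inl_inr, dist_iso_inr_inl, dist_iso_inr_inr]
    grind

variable [Fintype ι]

theorem mcount_subdivision_inl_inr [Fintype κ] (φ : completeBipartiteGraph ι κ ≃g G) (a : ι) (b : κ) :
    mcount (subdivision G) (.inl (φ (.inl a))) (.inr (biEdge φ a b)) =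
      (Fintype.card ι + 1) * (Fintype.card κ - 1) := by
  have : Nonempty ι := ⟨a⟩
  have : Nonempty κ := ⟨b⟩
  rw [mcount_subdivision_eq_ncard φ]
  trans (((({a} : Finset ι) ×ˢ ({b} : Finset κ)ᶜ).disjSum
    ((Finset.univ : Finset ι) ×ˢ ({b} : Finset κ)ᶜ) : Finset ((ι × κ) ⊕ (ι × κ))) : Set ((ι × κ) ⊕ (ι × κ))).ncard
  · congr 1
    ext (⟨i, j⟩ | ⟨i, j⟩)
    · simp [evdist_inl_halfEdge_inl, evdist_inr_halfEdge_inl]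
      grind
    · simp [evdist_inl_halfEdge_inr, evdist_inr_halfEdge_inr]
      grind
  · rw [Set.ncard_coe_finset]
    simp [Finset.card_compl]
    ring

theorem mcount_subdivision_inr_inl (φ : completeBipartiteGraph ι κ ≃g G) (a : ι) (b : κ) :
    mcount (subdivision G) (.inr (biEdge φ a b)) (.inl (φ (.inl a))) =
      (Fintype.card ι - 1) + Fintype.card ι := by
  have : Nonempty ι := ⟨a⟩
  have : Nonempty κ := ⟨b⟩
  rw [mcount_subdivision_eq_ncard φ]
  trans ((((({a} : Finset ι)ᶜ) ×ˢ ({b} : Finset κ)).disjSum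
    ((Finset.univ : Finset ι) ×ˢ ({b} : Finset κ)) : Finset ((ι × κ) ⊕ (ι × κ))) : Set ((ι × κ) ⊕ (ι × κ))).ncard
  · congr 1
    ext (⟨i, j⟩ | ⟨i, j⟩)
    · simp [evdist_inl_halfEdge_inl, evdist_inr_halfEdge_inl]
      grind
    · simp [evdist_inl_halfEdge_inr, evdist_inr_halfEdge_inr]
      grind
  · rw [Set.ncard_coe_finset]
    simp [Finset.card_compl]

end CompleteBipartite

/-- Exchanging the two parts of a complete bipartite graph. -/
def completeBipartiteGraphSwap (ι κ : Type*) :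
    completeBipartiteGraph ι κ ≃g completeBipartiteGraph κ ι where
  toEquiv := Equiv.sumComm ι κ
  map_rel_iff' := by rintro (_ | _) (_ | _) <;> simp

theorem mcount_subdivision_completeBipartiteGraph {ι : Type*} [Fintype ι] [DecidableEq ι]
    (v : ι ⊕ ι) (e : (completeBipartiteGraph ι ι).edgeSet) (hv : v ∈ (e : Sym2 (ι ⊕ ι))) :
    mcount (subdivision (completeBipartiteGraph ι ι)) (.inl v) (.inr e) =
        (Fintype.card ι + 1) * (Fintype.card ι - 1) ∧
      mcount (subdivision (completeBipartiteGraph ι ι)) (.inr e) (.inl v) =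
        (Fintype.card ι - 1) + Fintype.card ι := by
  obtain ⟨a, b, rfl⟩ := exists_eq_biEdge .refl e
  rw [coe_biEdge, Sym2.mem_iff] at hv
  rcases hv with rfl | rfl
  · exact ⟨mcount_subdivision_inl_inr .refl a b, mcount_subdivision_inr_inl .refl a b⟩
  · have he : biEdge .refl a b = biEdge (completeBipartiteGraphSwap ι ι) b a :=
      Subtype.ext Sym2.eq_swap
    rw [he]
    exact ⟨mcount_subdivision_inl_inr (completeBipartiteGraphSwap ι ι) b a,
      mcount_subdivision_inr_inl (completeBipartiteGraphSwap ι ι) b a⟩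

/-- Let `m ≥ 3` and let `S` be the subdivision graph of `K_{m,m}`. For a
rational `λ > 1`, `S` is edge quasi-λ-distance-balanced iff `λ = (m² - 1)/(2m - 1)`. -/
theorem subdivision_completeBipartite_isEQDB_iff (m : ℕ) (hm : 3 ≤ m)
    (lam : ℚ) (hlam : 1 < lam) :
    IsEQDB (subdivision (completeBipartiteGraph (Fin m) (Fin m))) lam ↔
      lam = ((m : ℚ) ^ 2 - 1) / (2 * (m : ℚ) - 1) := by
  have hm' : (3 : ℚ) ≤ m := by exact_mod_cast hm
  have hpos : (0 : ℚ) < 2 * m - 1 := by linarith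
  have count : ∀ v (e : (completeBipartiteGraph (Fin m) (Fin m)).edgeSet),
      v ∈ (e : Sym2 (Fin m ⊕ Fin m)) →
      (mcount (subdivision (completeBipartiteGraph (Fin m) (Fin m))) (.inl v) (.inr e) : ℚ) =
          (m : ℚ) ^ 2 - 1 ∧
        (mcount (subdivision (completeBipartiteGraph (Fin m) (Fin m))) (.inr e) (.inl v) : ℚ) =
          2 * m - 1 := by
    intro v e hv
    obtain ⟨h1, h2⟩ := mcount_subdivision_completeBipartiteGraph v e hv
    rw [h1, h2, Fintype.card_fin]
    push_cast [Nat.cast_sub (show 1 ≤ m by omega)]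
    constructor <;> ring
  constructor
  · intro h
    let a : Fin m := ⟨0, by omega⟩
    have hv : (Sum.inl a : Fin m ⊕ Fin m) ∈ (biEdge Iso.refl a a : Sym2 (Fin m ⊕ Fin m)) :=
      Sym2.mem_mk_left _ _
    obtain ⟨h1, h2⟩ := count _ _ hv
    have h3 := h (.inl (.inl a)) (.inr (biEdge .refl a a)) hv
    rw [h1, h2] at h3
    rcases h3 with h3 | h3
    · rw [eq_div_iff hpos.ne', h3]
    · nlinarith
  · rintro rfl (v | e) (w | f) h
    · exact absurd h (not_subdivision_adj_inl_inl _ _)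
    · obtain ⟨h1, h2⟩ := count _ _ h
      left
      rw [h1, h2, div_mul_cancel₀ _ hpos.ne']
    · obtain ⟨h1, h2⟩ := count _ _ h
      right
      rw [h1, h2, div_mul_cancel₀ _ hpos.ne']
    · exact absurd h (not_subdivision_adj_inr_inr _ _)
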